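/- (Geometry bound for ν.) In the standing setup, for X sufficiently large in terms of d, δ and ε, both of the following hold for all subsets I, I′, I″ ⊆ {1,…,d}: (i) ν ≤ δ + max(1, ∑_{i∈I} i·a_i + ∑_{i∈I′} i·b_i + ∑_{i∈I″} i·c_i) − ∑_{i∈I} a_i − ∑_{i∈I′} b_i − ∑_{i∈I″} c_i + ε; (ii) ν ≤ 4ε² + ∑_{i∉I} a_i + ∑_{i∉I′} b_i + ∑_{i∉I″} c_i + max(0, ∑_{i∈I} i·a_i + ∑_{i∈I′} i·b_i + ∑_{i∈I″} i·c_i − 1) + ε. -/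

import Mathlib

open Finset

/-- `Bcount d c₁ c₂ c₃ X Y Z` counts tuples `(x, y, z) ∈ ℕ^(3d)` with
`X i ≤ x i < 2 X i`, `Y i ≤ y i < 2 Y i`, `Z i ≤ z i < 2 Z i` (indices `i+1` run over
`1, …, d`), satisfying `c₁ ∏ x_j^j + c₂ ∏ y_j^j = c₃ ∏ z_j^j` and
`gcd(c₁ ∏ x_j, c₂ ∏ y_j, c₃ ∏ z_j) = 1`. -/
noncomputable def Bcount (d : ℕ) (c₁ c₂ c₃ : ℤ) (X Y Z : Fin d → ℝ) : ℕ :=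
  Set.ncard {t : (Fin d → ℕ) × (Fin d → ℕ) × (Fin d → ℕ) |
    (∀ i, X i ≤ (t.1 i : ℝ) ∧ (t.1 i : ℝ) < 2 * X i) ∧
    (∀ i, Y i ≤ (t.2.1 i : ℝ) ∧ (t.2.1 i : ℝ) < 2 * Y i) ∧
    (∀ i, Z i ≤ (t.2.2 i : ℝ) ∧ (t.2.2 i : ℝ) < 2 * Z i) ∧
    c₁ * ∏ j, (t.1 j : ℤ) ^ ((j : ℕ) + 1) + c₂ * ∏ j, (t.2.1 j : ℤ) ^ ((j : ℕ) + 1)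
      = c₃ * ∏ j, (t.2.2 j : ℤ) ^ ((j : ℕ) + 1) ∧
    Int.gcd (c₁ * ∏ j, (t.1 j : ℤ))
      ((Int.gcd (c₂ * ∏ j, (t.2.1 j : ℤ)) (c₃ * ∏ j, (t.2.2 j : ℤ)) : ℤ)) = 1}

/-- The exponent `ν = log B_d(c, X^a, X^b, X^c) / log X + 2ε²` of the standing setup. -/
noncomputable def nu (d : ℕ) (c₁ c₂ c₃ : ℤ) (X : ℝ) (a b c : Fin d → ℝ) (ε : ℝ) : ℝ :=
  Real.log (Bcount d c₁ c₂ c₃ (fun i => X ^ a i) (fun i => X ^ b i) (fun i => X ^ c i)) /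
    Real.log X + 2 * ε ^ 2

/-- The divisor bound `τ(n) ≪_η n ^ η`. -/
theorem exists_card_divisors_le_rpow {η : ℝ} (hη : 0 < η) :
    ∃ K : ℝ, 1 ≤ K ∧ ∀ n : ℕ, n ≠ 0 → (#n.divisors : ℝ) ≤ K * (n : ℝ) ^ η := by
  set L : ℝ := 1 + 1 / (η * Real.log 2)
  have hlog : 0 < Real.log 2 := Real.log_pos (by norm_num)
  have hL : 1 ≤ L := le_add_of_nonneg_right (by positivity)
  set P : ℕ := ⌈(2 : ℝ) ^ (1 / η)⌉₊
  have key : ∀ p k : ℕ, p.Prime →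
      (k + 1 : ℝ) ≤ (if p < P then L else 1) * ((p : ℝ) ^ k) ^ η := by
    intro p k hp
    have hp2 : (2 : ℝ) ≤ p := by exact_mod_cast hp.two_le
    rw [← Real.rpow_natCast, ← Real.rpow_mul (by positivity), mul_comm, mul_comm (k : ℝ),
      Real.rpow_mul (by positivity), Real.rpow_natCast]
    split_ifs with h
    · have h1 : 1 + η * Real.log 2 * k ≤ ((p : ℝ) ^ η) ^ k := by
        calc 1 + η * Real.log 2 * k ≤ Real.exp (η * Real.log 2 * k) := by
              linarith [Real.add_one_le_exp (η * Real.log 2 * k)]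
          _ = ((2 : ℝ) ^ η) ^ k := by
              rw [Real.rpow_def_of_pos (by norm_num), ← Real.exp_nat_mul]
              ring_nf
          _ ≤ _ := by gcongr
      calc (k + 1 : ℝ) ≤ (1 + η * Real.log 2 * k) * L := by
            have : (1 + η * Real.log 2 * k) * L
                = 1 + k + 1 / (η * Real.log 2) + η * Real.log 2 * k := by
              simp only [L]; field_simp; ring
            rw [this]
            have : 0 ≤ 1 / (η * Real.log 2) + η * Real.log 2 * k := by positivity
            linarith
        _ ≤ _ := by gcongr
    · have h2 : (2 : ℝ) ≤ (p : ℝ) ^ η := by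
        have : (2 : ℝ) ^ (1 / η) ≤ p := (Nat.le_ceil _).trans (by exact_mod_cast not_lt.1 h)
        calc (2 : ℝ) = ((2 : ℝ) ^ (1 / η)) ^ η := by
              rw [← Real.rpow_mul (by norm_num), one_div_mul_cancel hη.ne', Real.rpow_one]
          _ ≤ _ := by gcongr
      calc (k + 1 : ℝ) ≤ 2 ^ k := by exact_mod_cast Nat.lt_two_pow_self
        _ ≤ _ := by rw [mul_one]; gcongr
  refine ⟨L ^ P, one_le_pow₀ hL, fun n hn => ?_⟩
  have hfac : (n : ℝ) = ∏ p ∈ n.primeFactors, (p : ℝ) ^ n.factorization p := by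
    conv_lhs => rw [← Nat.prod_factorization_pow_eq_self hn]
    simp [Finsupp.prod]
  rw [Nat.card_divisors hn, hfac, ← Real.finsetProd_rpow _ _ (fun _ _ => by positivity)]
  push_cast
  calc ∏ p ∈ n.primeFactors, ((n.factorization p : ℝ) + 1)
      ≤ ∏ p ∈ n.primeFactors,
          (if p < P then L else 1) * ((p : ℝ) ^ n.factorization p) ^ η :=
        prod_le_prod (fun _ _ => by positivity)
          fun p hp => key p _ (Nat.prime_of_mem_primeFactors hp)
    _ ≤ _ := by
        rw [prod_mul_distrib]
        refine mul_le_mul_of_nonneg_right ?_ (prod_nonneg fun _ _ => by positivity)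
        rw [prod_ite, prod_const, prod_const_one, mul_one]
        refine pow_le_pow_right₀ hL ?_
        calc #{p ∈ n.primeFactors | p < P} ≤ #(range P) :=
              card_le_card fun p hp => by simpa using (mem_filter.1 hp).2
          _ = P := card_range P

/-- Coprimality of a triple depends only on the prime divisors of its entries. -/
theorem Int.gcd_gcd_eq_one_of_prime_dvd {a b c a' b' c' : ℤ}
    (h : Int.gcd a (Int.gcd b c) = 1)
    (ha : ∀ p : ℤ, Prime p → p ∣ a' → p ∣ a) (hb : ∀ p : ℤ, Prime p → p ∣ b' → p ∣ b)
    (hc : ∀ p : ℤ, Prime p → p ∣ c' → p ∣ c) :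
    Int.gcd a' (Int.gcd b' c') = 1 := by
  rw [Nat.eq_one_iff_not_exists_prime_dvd]
  intro p hp hdvd
  have hp' : Prime (p : ℤ) := Nat.prime_iff_prime_int.1 hp
  have h0 : (p : ℤ) ∣ (Int.gcd a' (Int.gcd b' c') : ℤ) := by exact_mod_cast hdvd
  have h1 := h0.trans (Int.gcd_dvd_left ..)
  have h2 := h0.trans (Int.gcd_dvd_right ..)
  have h3 := Int.dvd_coe_gcd (ha _ hp' h1)
    (Int.dvd_coe_gcd (hb _ hp' (h2.trans (Int.gcd_dvd_left ..)))
    (hc _ hp' (h2.trans (Int.gcd_dvd_right ..))))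
  rw [h] at h3
  exact hp'.not_dvd_one (by exact_mod_cast h3)

theorem Prime.dvd_prod_of_dvd_prod_pow {ι : Type*} {s t : Finset ι} (hst : s ⊆ t)
    {f : ι → ℤ} {e : ι → ℕ} {p : ℤ} (hp : Prime p) (h : p ∣ ∏ i ∈ s, f i ^ e i) :
    p ∣ ∏ i ∈ t, f i := by
  obtain ⟨i, hi, hd⟩ := hp.exists_mem_finset_dvd h
  exact (hp.dvd_of_dvd_pow hd).trans (dvd_prod_of_mem f (hst hi))

/-- Two primitive positive solutions of a primitive ternary linear equation either agree or
span a parallelogram whose projection has area divisible by the last coefficient. -/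
theorem eq_or_abs_le_abs_det {A B C : ℤ} {u v w u' v' w' : ℕ}
    (hABC : Int.gcd A (Int.gcd B C) = 1) (hC : C ≠ 0)
    (h : A * u + B * v = C * w) (h' : A * u' + B * v' = C * w')
    (hp : Nat.gcd u (Nat.gcd v w) = 1) (hp' : Nat.gcd u' (Nat.gcd v' w') = 1) :
    (u = u' ∧ v = v' ∧ w = w') ∨ |C| ≤ |(u * v' - u' * v : ℤ)| := by
  by_cases hdet : (u * v' - u' * v : ℤ) = 0
  · left
    have e1 : u * v' = u' * v := by zify; linarith
    have e2 : w * v' = w' * v := by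
      zify
      apply mul_left_cancel₀ hC
      linear_combination A * hdet - v' * h + v * h'
    have e3 : w * u' = w' * u := by
      zify
      apply mul_left_cancel₀ hC
      linear_combination -B * hdet - u' * h + u * h'
    have g : ∀ k : ℕ, k * Nat.gcd u (Nat.gcd v w)
        = Nat.gcd (k * u) (Nat.gcd (k * v) (k * w)) := fun k => by
      rw [Nat.gcd_mul_left, Nat.gcd_mul_left]
    have g' : ∀ k : ℕ, k * Nat.gcd u' (Nat.gcd v' w')
        = Nat.gcd (k * u') (Nat.gcd (k * v') (k * w')) := fun k => by
      rw [Nat.gcd_mul_left, Nat.gcd_mul_left]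
    simp only [hp, hp', mul_one] at g g'
    refine ⟨?_, ?_, ?_⟩
    · calc u = _ := g' u
        _ = Nat.gcd (u' * u) (Nat.gcd (u' * v) (u' * w)) := by
          rw [e1, mul_comm u u', mul_comm u w', ← e3, mul_comm w]
        _ = u' := (g u').symm
    · calc v = _ := g' v
        _ = Nat.gcd (v' * u) (Nat.gcd (v' * v) (v' * w)) := by
          rw [mul_comm v u', ← e1, mul_comm v w', ← e2, mul_comm v v', mul_comm u, mul_comm w]
        _ = v' := (g v').symm
    · calc w = _ := g' w
        _ = Nat.gcd (w' * u) (Nat.gcd (w' * v) (w' * w)) := by rw [e2, e3, mul_comm w w']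
        _ = w' := (g w').symm
  · right
    have hCA : C ∣ A * (u * v' - u' * v) := ⟨w * v' - w' * v, by linear_combination v' * h - v * h'⟩
    have hCB : C ∣ B * (u * v' - u' * v) := ⟨u * w' - u' * w, by linear_combination u * h' - u' * h⟩
    have hCC : C ∣ C * (u * v' - u' * v) := dvd_mul_right _ _
    have hCD : C ∣ (u * v' - u' * v) := by
      have h1 : C ∣ (Int.gcd B C : ℤ) * (u * v' - u' * v) := by
        rw [Int.gcd_eq_gcd_ab, add_mul]
        exact dvd_add (by convert hCB.mul_right (Int.gcdA B C) using 1; ring)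
          (by convert hCC.mul_right (Int.gcdB B C) using 1; ring)
      have h2 : ((Int.gcd A (Int.gcd B C) : ℕ) : ℤ) = 1 := by rw [hABC]; rfl
      rw [Int.gcd_eq_gcd_ab] at h2
      rw [← one_mul (_ - _ : ℤ), ← h2, add_mul]
      exact dvd_add (by convert hCA.mul_right (Int.gcdA A (Int.gcd B C)) using 1; ring)
        (by convert h1.mul_right (Int.gcdB A (Int.gcd B C)) using 1; ring)
    exact Int.le_of_dvd (abs_pos.2 hdet) ((abs_dvd_abs _ _).2 hCD)

section Box

variable {d : ℕ} {X : Fin d → ℝ} {x : Fin d → ℕ}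

theorem prod_pow_le_of_mem_box (hX : ∀ i, 1 ≤ X i) (hx : ∀ i, X i ≤ x i ∧ (x i : ℝ) < 2 * X i)
    (I : Finset (Fin d)) :
    ∏ i ∈ I, X i ^ ((i : ℕ) + 1) ≤ ∏ i ∈ I, (x i : ℝ) ^ ((i : ℕ) + 1) :=
  prod_le_prod (fun i _ => pow_nonneg (zero_le_one.trans (hX i)) _) fun i _ =>
    pow_le_pow_left₀ (zero_le_one.trans (hX i)) (hx i).1 _

theorem prod_pow_le_two_pow_mul (hX : ∀ i, 1 ≤ X i)
    (hx : ∀ i, X i ≤ x i ∧ (x i : ℝ) < 2 * X i) (I : Finset (Fin d)) :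
    ∏ i ∈ I, (x i : ℝ) ^ ((i : ℕ) + 1) ≤
      2 ^ (∑ i : Fin d, ((i : ℕ) + 1)) * ∏ i ∈ I, X i ^ ((i : ℕ) + 1) := by
  have h0 : ∀ i, 0 ≤ X i := fun i => zero_le_one.trans (hX i)
  calc ∏ i ∈ I, (x i : ℝ) ^ ((i : ℕ) + 1) ≤ ∏ i ∈ I, (2 * X i) ^ ((i : ℕ) + 1) :=
        prod_le_prod (fun _ _ => by positivity) fun i _ =>
          pow_le_pow_left₀ (by positivity) (hx i).2.le _
    _ = 2 ^ (∑ i ∈ I, ((i : ℕ) + 1)) * ∏ i ∈ I, X i ^ ((i : ℕ) + 1) := by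
        simp_rw [mul_pow]
        rw [prod_mul_distrib, prod_pow_eq_pow_sum]
    _ ≤ _ := by
        refine mul_le_mul_of_nonneg_right (pow_le_pow_right₀ (by norm_num) ?_)
          (prod_nonneg fun i _ => pow_nonneg (h0 i) _)
        exact sum_le_sum_of_subset (subset_univ I)

/-- The coordinates of `x` outside `I`, padded by zeros. -/
def eraseCoords (I : Finset (Fin d)) (x : Fin d → ℕ) : Fin d → ℕ :=
  fun i => if i ∈ I then 0 else x i

/-- A finite set containing `eraseCoords I x` for all `x` in the box `X ≤ x < 2 X`. -/
noncomputable def erasedBox (I : Finset (Fin d)) (X : Fin d → ℝ) : Finset (Fin d → ℕ) :=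
  Fintype.piFinset fun i => if i ∈ I then {0} else range (⌊2 * X i⌋₊ + 1)

theorem eraseCoords_mem_erasedBox (hx : ∀ i, X i ≤ x i ∧ (x i : ℝ) < 2 * X i)
    (I : Finset (Fin d)) : eraseCoords I x ∈ erasedBox I X := by
  refine Fintype.mem_piFinset.2 fun i => ?_
  unfold eraseCoords
  split_ifs with h
  · simp
  · rw [mem_range, Nat.lt_succ_iff]
    exact Nat.le_floor (hx i).2.le

theorem eq_of_eraseCoords_eq {I : Finset (Fin d)} {y : Fin d → ℕ}
    (h : eraseCoords I x = eraseCoords I y) {i : Fin d} (hi : i ∉ I) : x i = y i := by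
  simpa [eraseCoords, hi] using congrFun h i

theorem card_erasedBox_le (hX : ∀ i, 1 ≤ X i) (I : Finset (Fin d)) :
    (#(erasedBox I X) : ℝ) ≤ 3 ^ d * ∏ i ∈ Iᶜ, X i := by
  have h0 : ∀ i, 0 ≤ X i := fun i => zero_le_one.trans (hX i)
  have hcard : (#(erasedBox I X) : ℝ) ≤ ∏ i ∈ Iᶜ, (3 * X i) := by
    rw [erasedBox, Fintype.card_piFinset, ← prod_mul_prod_compl I, prod_congr rfl
      (g := fun _ => 1) (fun i hi => by simp [hi]), prod_const_one, one_mul]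
    push_cast
    refine prod_le_prod (fun _ _ => by positivity) fun i hi => ?_
    rw [if_neg (mem_compl.1 hi), card_range]
    push_cast
    linarith [Nat.floor_le (show 0 ≤ 2 * X i by linarith [h0 i]), hX i]
  refine hcard.trans ?_
  rw [prod_mul_distrib, prod_const]
  refine mul_le_mul_of_nonneg_right (pow_le_pow_right₀ (by norm_num) ?_)
    (prod_nonneg fun i _ => h0 i)
  simpa using card_le_univ (Iᶜ : Finset (Fin d))

end Box

section Counting

variable {d : ℕ}

/-- The set counted by `Bcount`. -/
def boxSolutions (d : ℕ) (c₁ c₂ c₃ : ℤ) (X Y Z : Fin d → ℝ) :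
    Set ((Fin d → ℕ) × (Fin d → ℕ) × (Fin d → ℕ)) :=
  {t | (∀ i, X i ≤ (t.1 i : ℝ) ∧ (t.1 i : ℝ) < 2 * X i) ∧
    (∀ i, Y i ≤ (t.2.1 i : ℝ) ∧ (t.2.1 i : ℝ) < 2 * Y i) ∧
    (∀ i, Z i ≤ (t.2.2 i : ℝ) ∧ (t.2.2 i : ℝ) < 2 * Z i) ∧
    c₁ * ∏ j, (t.1 j : ℤ) ^ ((j : ℕ) + 1) + c₂ * ∏ j, (t.2.1 j : ℤ) ^ ((j : ℕ) + 1)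
      = c₃ * ∏ j, (t.2.2 j : ℤ) ^ ((j : ℕ) + 1) ∧
    Int.gcd (c₁ * ∏ j, (t.1 j : ℤ))
      ((Int.gcd (c₂ * ∏ j, (t.2.1 j : ℤ)) (c₃ * ∏ j, (t.2.2 j : ℤ)) : ℤ)) = 1}

/-- The weighted product `∏ x_j ^ j` over a set `I` of coordinates. -/
def partProd (I : Finset (Fin d)) (x : Fin d → ℕ) : ℕ := ∏ i ∈ I, x i ^ ((i : ℕ) + 1)

theorem partProd_compl_mul (I : Finset (Fin d)) (x : Fin d → ℕ) :
    partProd Iᶜ x * partProd I x = partProd univ x :=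
  prod_compl_mul_prod I _

theorem partProd_compl_eq {I : Finset (Fin d)} {x y : Fin d → ℕ}
    (h : eraseCoords I x = eraseCoords I y) : partProd Iᶜ x = partProd Iᶜ y :=
  prod_congr rfl fun i hi => by rw [eq_of_eraseCoords_eq h (mem_compl.1 hi)]

theorem cast_partProd_univ (x : Fin d → ℕ) :
    (partProd univ x : ℤ) = ∏ j, (x j : ℤ) ^ ((j : ℕ) + 1) := by
  simp [partProd]

theorem partProd_pos {X : Fin d → ℝ} {x : Fin d → ℕ} (hX : ∀ i, 1 ≤ X i)
    (hx : ∀ i, X i ≤ x i ∧ (x i : ℝ) < 2 * X i) (I : Finset (Fin d)) : 0 < partProd I x :=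
  prod_pos fun i _ => pow_pos (by exact_mod_cast zero_lt_one.trans_le ((hX i).trans (hx i).1)) _

theorem Prime.dvd_mul_prod_of_dvd_mul_partProd {c p : ℤ} (hp : Prime p) {I : Finset (Fin d)}
    {x : Fin d → ℕ} (h : p ∣ c * (partProd I x : ℤ)) : p ∣ c * ∏ j, (x j : ℤ) := by
  rcases hp.dvd_or_dvd h with h | h
  · exact h.mul_right _
  · rw [partProd] at h
    push_cast at h
    exact (hp.dvd_prod_of_dvd_prod_pow (subset_univ I) h).mul_left _

/-- Coefficients and variables of the linear equation obtained by freezing the coordinates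
outside `I`, `I'`, `I''`. -/
theorem linear_equation_of_mem_boxSolutions {c₁ c₂ c₃ : ℤ} {X Y Z : Fin d → ℝ}
    {t : (Fin d → ℕ) × (Fin d → ℕ) × (Fin d → ℕ)} (ht : t ∈ boxSolutions d c₁ c₂ c₃ X Y Z)
    (I I' I'' : Finset (Fin d)) :
    (c₁ * partProd Iᶜ t.1) * (partProd I t.1 : ℤ)
        + (c₂ * partProd I'ᶜ t.2.1) * (partProd I' t.2.1 : ℤ)
      = (c₃ * partProd I''ᶜ t.2.2) * (partProd I'' t.2.2 : ℤ) ∧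
    Int.gcd (c₁ * partProd Iᶜ t.1)
      (Int.gcd (c₂ * partProd I'ᶜ t.2.1) (c₃ * partProd I''ᶜ t.2.2)) = 1 ∧
    Nat.gcd (partProd I t.1) (Nat.gcd (partProd I' t.2.1) (partProd I'' t.2.2)) = 1 := by
  obtain ⟨-, -, -, heq, hgcd⟩ := ht
  refine ⟨?_, ?_, ?_⟩
  · simp only [← cast_partProd_univ] at heq
    rw [← partProd_compl_mul I, ← partProd_compl_mul I', ← partProd_compl_mul I''] at heq
    push_cast at heq
    linear_combination heq
  · exact Int.gcd_gcd_eq_one_of_prime_dvd hgcd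
      (fun p hp => hp.dvd_mul_prod_of_dvd_mul_partProd)
      (fun p hp => hp.dvd_mul_prod_of_dvd_mul_partProd)
      (fun p hp => hp.dvd_mul_prod_of_dvd_mul_partProd)
  · have := Int.gcd_gcd_eq_one_of_prime_dvd (a' := partProd I t.1) (b' := partProd I' t.2.1)
      (c' := partProd I'' t.2.2) hgcd
      (fun p hp h => hp.dvd_mul_prod_of_dvd_mul_partProd (h.mul_left _))
      (fun p hp h => hp.dvd_mul_prod_of_dvd_mul_partProd (h.mul_left _))
      (fun p hp h => hp.dvd_mul_prod_of_dvd_mul_partProd (h.mul_left _))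
    simpa [Int.gcd_natCast_natCast] using this

/-- The number of positions available for the slope of a primitive solution. -/
noncomputable def slopeScale (I I'' : Finset (Fin d)) (X Z : Fin d → ℝ) : ℝ :=
  (2 ^ (∑ i : Fin d, ((i : ℕ) + 1)) * ∏ i ∈ I, X i ^ ((i : ℕ) + 1)) ^ 2 /
    ∏ i ∈ I''ᶜ, Z i ^ ((i : ℕ) + 1)

theorem partProd_eq_of_floor_eq {c₁ c₂ c₃ : ℤ} (hc₃ : c₃ ≠ 0) {X Y Z : Fin d → ℝ}
    (hX : ∀ i, 1 ≤ X i) (hZ : ∀ i, 1 ≤ Z i)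
    {I I' I'' : Finset (Fin d)} {t t' : (Fin d → ℕ) × (Fin d → ℕ) × (Fin d → ℕ)}
    (ht : t ∈ boxSolutions d c₁ c₂ c₃ X Y Z) (ht' : t' ∈ boxSolutions d c₁ c₂ c₃ X Y Z)
    (h₁ : eraseCoords I t.1 = eraseCoords I t'.1)
    (h₂ : eraseCoords I' t.2.1 = eraseCoords I' t'.2.1)
    (h₃ : eraseCoords I'' t.2.2 = eraseCoords I'' t'.2.2)
    (hfl : ⌊slopeScale I I'' X Z * (partProd I' t.2.1 / partProd I t.1 : ℝ)⌋₊ =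
      ⌊slopeScale I I'' X Z * (partProd I' t'.2.1 / partProd I t'.1 : ℝ)⌋₊) :
    partProd univ t.1 = partProd univ t'.1 ∧ partProd univ t.2.1 = partProd univ t'.2.1 ∧
      partProd univ t.2.2 = partProd univ t'.2.2 := by
  obtain ⟨e, g, p⟩ := linear_equation_of_mem_boxSolutions ht I I' I''
  obtain ⟨e', -, p'⟩ := linear_equation_of_mem_boxSolutions ht' I I' I''
  rw [← partProd_compl_eq h₁, ← partProd_compl_eq h₂, ← partProd_compl_eq h₃] at e'
  have hu := partProd_pos hX ht.1 I
  have hu' := partProd_pos hX ht'.1 I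
  have hw := partProd_pos hZ ht.2.2.1 I''ᶜ
  have hC : c₃ * (partProd I''ᶜ t.2.2 : ℤ) ≠ 0 := mul_ne_zero hc₃ (by exact_mod_cast hw.ne')
  rcases eq_or_abs_le_abs_det g hC e e' p p' with ⟨h, h', h''⟩ | h
  · rw [← partProd_compl_mul I t.1, ← partProd_compl_mul I t'.1, ← partProd_compl_mul I' t.2.1,
      ← partProd_compl_mul I' t'.2.1, ← partProd_compl_mul I'' t.2.2,
      ← partProd_compl_mul I'' t'.2.2, h, h', h'', partProd_compl_eq h₁, partProd_compl_eq h₂,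
      partProd_compl_eq h₃]
    exact ⟨rfl, rfl, rfl⟩
  exfalso
  set C₀ : ℝ := ∏ i ∈ I''ᶜ, Z i ^ ((i : ℕ) + 1)
  set U : ℝ := 2 ^ (∑ i : Fin d, ((i : ℕ) + 1)) * ∏ i ∈ I, X i ^ ((i : ℕ) + 1)
  have hC₀ : 0 < C₀ := prod_pos fun i _ => pow_pos (zero_lt_one.trans_le (hZ i)) _
  have hU : 0 < U := mul_pos (by positivity)
    (prod_pos fun i _ => pow_pos (zero_lt_one.trans_le (hX i)) _)
  have hs : slopeScale I I'' X Z = U ^ 2 / C₀ := rfl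
  have hCle : C₀ ≤
      |(partProd I t.1 * partProd I' t'.2.1 - partProd I t'.1 * partProd I' t.2.1 : ℝ)| := by
    have h1 : C₀ ≤ (partProd I''ᶜ t.2.2 : ℝ) := by
      have := prod_pow_le_of_mem_box hZ ht.2.2.1 I''ᶜ
      simpa [partProd] using this
    have h2 : (partProd I''ᶜ t.2.2 : ℤ) ≤ |c₃ * (partProd I''ᶜ t.2.2 : ℤ)| := by
      rw [abs_mul, abs_of_nonneg (Nat.cast_nonneg' (partProd I''ᶜ t.2.2) : (0 : ℤ) ≤ _)]
      exact le_mul_of_one_le_left (Nat.cast_nonneg' _) (Int.one_le_abs hc₃)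
    have h3 := h2.trans h
    exact h1.trans (by exact_mod_cast h3)
  have hUu : (partProd I t.1 : ℝ) ≤ U := by
    have := prod_pow_le_two_pow_mul hX ht.1 I
    simpa [partProd] using this
  have hUu' : (partProd I t'.1 : ℝ) ≤ U := by
    have := prod_pow_le_two_pow_mul hX ht'.1 I
    simpa [partProd] using this
  rw [hs] at hfl
  have hu0 : (0 : ℝ) < partProd I t.1 := by exact_mod_cast hu
  have hu0' : (0 : ℝ) < partProd I t'.1 := by exact_mod_cast hu'
  generalize (partProd I t.1 : ℝ) = u at *
  generalize (partProd I t'.1 : ℝ) = u' at *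
  have hv0 : (0 : ℝ) ≤ partProd I' t.2.1 := Nat.cast_nonneg _
  have hv0' : (0 : ℝ) ≤ partProd I' t'.2.1 := Nat.cast_nonneg _
  generalize (partProd I' t.2.1 : ℝ) = v at *
  generalize (partProd I' t'.2.1 : ℝ) = v' at *
  have hlt : |U ^ 2 / C₀ * (v' / u') - U ^ 2 / C₀ * (v / u)| < 1 := by
    have a1 := Nat.floor_le (show 0 ≤ U ^ 2 / C₀ * (v / u) by positivity)
    have a2 := Nat.lt_floor_add_one (U ^ 2 / C₀ * (v / u))
    have a3 := Nat.floor_le (show 0 ≤ U ^ 2 / C₀ * (v' / u') by positivity)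
    have a4 := Nat.lt_floor_add_one (U ^ 2 / C₀ * (v' / u'))
    rw [hfl] at a1 a2
    rw [abs_lt]
    constructor <;> linarith
  have heq : U ^ 2 / C₀ * (v' / u') - U ^ 2 / C₀ * (v / u)
      = (U * U / (u * u')) * ((u * v' - u' * v) / C₀) := by
    field_simp
  rw [heq, abs_mul, abs_div (u * v' - u' * v), abs_of_pos hC₀,
    abs_of_pos (by positivity : 0 < U * U / (u * u'))] at hlt
  have b1 : 1 ≤ U * U / (u * u') := by
    rw [one_le_div (by positivity)]
    exact mul_le_mul hUu hUu' hu0'.le hU.le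
  have b2 : 1 ≤ |u * v' - u' * v| / C₀ := by rwa [one_le_div hC₀]
  exact absurd hlt (not_lt.2 (one_le_mul_of_one_le_of_one_le b1 b2))

theorem boxSolutions_finite (c₁ c₂ c₃ : ℤ) (X Y Z : Fin d → ℝ) :
    (boxSolutions d c₁ c₂ c₃ X Y Z).Finite := by
  refine ((erasedBox ∅ X ×ˢ erasedBox ∅ Y ×ˢ erasedBox ∅ Z).finite_toSet).subset fun t ht => ?_
  have h : ∀ x : Fin d → ℕ, eraseCoords ∅ x = x := fun x => by ext; simp [eraseCoords]
  rw [mem_coe, mem_product, mem_product, ← h t.1, ← h t.2.1, ← h t.2.2]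
  exact ⟨eraseCoords_mem_erasedBox ht.1 _, eraseCoords_mem_erasedBox ht.2.1 _,
    eraseCoords_mem_erasedBox ht.2.2.1 _⟩

theorem mem_piFinset_divisors_partProd {x : Fin d → ℕ} {n : ℕ} (hn : n ≠ 0)
    (h : partProd univ x = n) : x ∈ Fintype.piFinset fun _ : Fin d => n.divisors := by
  refine Fintype.mem_piFinset.2 fun i => Nat.mem_divisors.2 ⟨?_, hn⟩
  rw [← h]
  exact (dvd_pow_self _ (Nat.succ_ne_zero _)).trans
    (dvd_prod_of_mem (fun i : Fin d => x i ^ ((i : ℕ) + 1)) (mem_univ i))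

/-- Freezing the coordinates outside `I`, `I'`, `I''` bounds the number of solutions, where `M`
bounds the number of factorisations of the full products. -/
theorem Bcount_le {c₁ c₂ c₃ : ℤ} (hc₃ : c₃ ≠ 0) {X Y Z : Fin d → ℝ}
    (hX : ∀ i, 1 ≤ X i) (hY : ∀ i, 1 ≤ Y i) (hZ : ∀ i, 1 ≤ Z i) {N : ℝ} {M : ℕ}
    (hXN : ∏ i, X i ^ ((i : ℕ) + 1) ≤ N) (hYN : ∏ i, Y i ^ ((i : ℕ) + 1) ≤ N)
    (hZN : ∏ i, Z i ^ ((i : ℕ) + 1) ≤ N)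
    (hM : ∀ n : ℕ, n ≠ 0 → (n : ℝ) ≤ 2 ^ (∑ i : Fin d, ((i : ℕ) + 1)) * N → #n.divisors ^ d ≤ M)
    (I I' I'' : Finset (Fin d)) :
    (Bcount d c₁ c₂ c₃ X Y Z : ℝ) ≤
      (M : ℝ) ^ 3 * (((3 ^ d * ∏ i ∈ Iᶜ, X i) * ((3 ^ d * ∏ i ∈ I'ᶜ, Y i) *
        (3 ^ d * ∏ i ∈ I''ᶜ, Z i))) *
        ((2 ^ (∑ i : Fin d, ((i : ℕ) + 1))) ^ 3 * ((∏ i ∈ I, X i ^ ((i : ℕ) + 1)) *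
          (∏ i ∈ I', Y i ^ ((i : ℕ) + 1)) / ∏ i ∈ I''ᶜ, Z i ^ ((i : ℕ) + 1)) + 1)) := by
  classical
  set T := (boxSolutions_finite c₁ c₂ c₃ X Y Z).toFinset with hT
  have hmem : ∀ {t}, t ∈ T ↔ t ∈ boxSolutions d c₁ c₂ c₃ X Y Z := by simp [hT]
  have hB : Bcount d c₁ c₂ c₃ X Y Z = #T := Set.ncard_eq_toFinset_card _ _
  set R : ℝ := (2 ^ (∑ i : Fin d, ((i : ℕ) + 1))) ^ 3 * ((∏ i ∈ I, X i ^ ((i : ℕ) + 1)) *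
          (∏ i ∈ I', Y i ^ ((i : ℕ) + 1)) / ∏ i ∈ I''ᶜ, Z i ^ ((i : ℕ) + 1)) with hR
  have hpX : 0 < ∏ i ∈ I, X i ^ ((i : ℕ) + 1) :=
    prod_pos fun i _ => pow_pos (zero_lt_one.trans_le (hX i)) _
  have hpY : 0 < ∏ i ∈ I', Y i ^ ((i : ℕ) + 1) :=
    prod_pos fun i _ => pow_pos (zero_lt_one.trans_le (hY i)) _
  have hpZ : 0 < ∏ i ∈ I''ᶜ, Z i ^ ((i : ℕ) + 1) :=
    prod_pos fun i _ => pow_pos (zero_lt_one.trans_le (hZ i)) _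
  have hR0 : 0 ≤ R := by positivity
  have hscale : 0 ≤ slopeScale I I'' X Z := div_nonneg (sq_nonneg _) hpZ.le
  let f : ((Fin d → ℕ) × (Fin d → ℕ) × (Fin d → ℕ)) →
      ((Fin d → ℕ) × (Fin d → ℕ) × (Fin d → ℕ)) × ℕ := fun t =>
    ((eraseCoords I t.1, eraseCoords I' t.2.1, eraseCoords I'' t.2.2),
      ⌊slopeScale I I'' X Z * (partProd I' t.2.1 / partProd I t.1 : ℝ)⌋₊)
  let S := (erasedBox I X ×ˢ erasedBox I' Y ×ˢ erasedBox I'' Z) ×ˢ range (⌊R⌋₊ + 1)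
  have hmaps : ∀ t ∈ T, f t ∈ S := by
    intro t ht
    rw [hmem] at ht
    refine mem_product.2 ⟨mem_product.2 ⟨eraseCoords_mem_erasedBox ht.1 _,
      mem_product.2 ⟨eraseCoords_mem_erasedBox ht.2.1 _,
        eraseCoords_mem_erasedBox ht.2.2.1 _⟩⟩, ?_⟩
    rw [mem_range, Nat.lt_succ_iff]
    refine Nat.floor_mono ?_
    calc slopeScale I I'' X Z * (partProd I' t.2.1 / partProd I t.1 : ℝ)
        ≤ slopeScale I I'' X Z * ((2 ^ (∑ i : Fin d, ((i : ℕ) + 1)) *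
          ∏ i ∈ I', Y i ^ ((i : ℕ) + 1)) / ∏ i ∈ I, X i ^ ((i : ℕ) + 1)) := by
          refine mul_le_mul_of_nonneg_left (div_le_div₀ ?_ ?_ hpX ?_) hscale
          · positivity
          · simpa [partProd] using prod_pow_le_two_pow_mul hY ht.2.1 I'
          · simpa [partProd] using prod_pow_le_of_mem_box hX ht.1 I
      _ = R := by
          rw [slopeScale, hR]
          field_simp
  have hfib : ∀ s ∈ S, #{t ∈ T | f t = s} ≤ M ^ 3 := by
    intro s _
    rcases Finset.eq_empty_or_nonempty {t ∈ T | f t = s} with h | ⟨t₀, ht₀⟩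
    · simp [h]
    obtain ⟨ht₀, hf₀⟩ := mem_filter.1 ht₀
    rw [hmem] at ht₀
    have hbound : ∀ {W : Fin d → ℝ} {x : Fin d → ℕ}, (∀ i, 1 ≤ W i) →
        (∀ i, W i ≤ x i ∧ (x i : ℝ) < 2 * W i) → ∏ i, W i ^ ((i : ℕ) + 1) ≤ N →
        #(Fintype.piFinset fun _ : Fin d => (partProd univ x).divisors) ≤ M := by
      intro W x hW hx hWN
      rw [Fintype.card_piFinset_const]
      refine hM _ (partProd_pos hW hx _).ne' ?_
      calc (partProd univ x : ℝ)
          ≤ 2 ^ (∑ i : Fin d, ((i : ℕ) + 1)) * ∏ i, W i ^ ((i : ℕ) + 1) := by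
            simpa [partProd] using prod_pow_le_two_pow_mul hW hx univ
        _ ≤ _ := by gcongr
    calc #{t ∈ T | f t = s}
        ≤ #((Fintype.piFinset fun _ : Fin d => (partProd univ t₀.1).divisors) ×ˢ
          (Fintype.piFinset fun _ : Fin d => (partProd univ t₀.2.1).divisors) ×ˢ
          (Fintype.piFinset fun _ : Fin d => (partProd univ t₀.2.2).divisors)) := by
          refine card_le_card fun t ht => ?_
          obtain ⟨ht, hf⟩ := mem_filter.1 ht
          rw [hmem] at ht
          rw [← hf₀] at hf
          simp only [f, Prod.mk.injEq] at hf
          obtain ⟨⟨h₁, h₂, h₃⟩, h₄⟩ := hf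
          obtain ⟨e₁, e₂, e₃⟩ := partProd_eq_of_floor_eq hc₃ hX hZ ht ht₀ h₁ h₂ h₃ h₄
          exact mem_product.2 ⟨mem_piFinset_divisors_partProd (partProd_pos hX ht₀.1 _).ne' e₁,
            mem_product.2 ⟨mem_piFinset_divisors_partProd (partProd_pos hY ht₀.2.1 _).ne' e₂,
              mem_piFinset_divisors_partProd (partProd_pos hZ ht₀.2.2.1 _).ne' e₃⟩⟩
      _ ≤ M * (M * M) := by
          rw [card_product, card_product]
          exact Nat.mul_le_mul (hbound hX ht₀.1 hXN)
            (Nat.mul_le_mul (hbound hY ht₀.2.1 hYN) (hbound hZ ht₀.2.2.1 hZN))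
      _ = M ^ 3 := by ring
  have hcard := card_le_mul_card_image_of_maps_to hmaps _ hfib
  rw [hB]
  calc (#T : ℝ) ≤ (M : ℝ) ^ 3 * #S := by exact_mod_cast hcard
    _ ≤ _ := by
      refine mul_le_mul_of_nonneg_left ?_ (by positivity)
      simp only [S, card_product, card_range]
      push_cast
      have p : ∀ {W : Fin d → ℝ} (J : Finset (Fin d)), (∀ i, 1 ≤ W i) →
          0 ≤ 3 ^ d * ∏ i ∈ J, W i := fun J hW =>
        mul_nonneg (by positivity) (prod_nonneg fun i _ => zero_le_one.trans (hW i))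
      refine mul_le_mul (mul_le_mul (card_erasedBox_le hX I)
        (mul_le_mul (card_erasedBox_le hY I') (card_erasedBox_le hZ I'') (by positivity)
          (p _ hY)) (by positivity) (p _ hX)) ?_ (by positivity)
        (mul_nonneg (p _ hX) (mul_nonneg (p _ hY) (p _ hZ)))
      linarith [Nat.floor_le hR0]

end Counting

theorem prod_rpow_eq_rpow_sum {ι : Type*} {X : ℝ} (hX : 0 < X) (a : ι → ℝ) (J : Finset ι) :
    ∏ i ∈ J, X ^ a i = X ^ ∑ i ∈ J, a i :=
  (Real.rpow_sum_of_pos hX a J).symm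

theorem prod_rpow_pow_eq_rpow_sum {d : ℕ} {X : ℝ} (hX : 0 < X) (a : Fin d → ℝ)
    (J : Finset (Fin d)) :
    ∏ i ∈ J, (X ^ a i) ^ ((i : ℕ) + 1) = X ^ ∑ i ∈ J, ((i : ℕ) + 1 : ℝ) * a i := by
  rw [← prod_rpow_eq_rpow_sum hX]
  refine prod_congr rfl fun i _ => ?_
  rw [← Real.rpow_natCast, ← Real.rpow_mul hX.le, mul_comm]
  push_cast
  rfl

/-- The bound for `Bcount` in terms of exponents, with an explicit power saving. -/
theorem exists_Bcount_le_rpow (d : ℕ) {ε : ℝ} (hε : 0 < ε) (hε' : ε < 1 / 100) :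
    ∃ K : ℝ, 1 ≤ K ∧ ∀ X : ℝ, 2 ≤ X →
      ∀ a b c : Fin d → ℝ, (∀ i, 0 ≤ a i) → (∀ i, 0 ≤ b i) → (∀ i, 0 ≤ c i) →
        (∑ i : Fin d, ((i : ℕ) + 1 : ℝ) * a i ≤ 1) →
        (∑ i : Fin d, ((i : ℕ) + 1 : ℝ) * b i ≤ 1) →
        (1 - ε ^ 2 ≤ ∑ i : Fin d, ((i : ℕ) + 1 : ℝ) * c i) →
        (∑ i : Fin d, ((i : ℕ) + 1 : ℝ) * c i ≤ 1) →
        ∀ c₁ c₂ c₃ : ℤ, c₃ ≠ 0 → ∀ I I' I'' : Finset (Fin d),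
          (Bcount d c₁ c₂ c₃ (fun i => X ^ a i) (fun i => X ^ b i) (fun i => X ^ c i) : ℝ) ≤
            K * X ^ (ε / 4 + ((∑ i ∈ Iᶜ, a i) + (∑ i ∈ I'ᶜ, b i) + (∑ i ∈ I''ᶜ, c i)) +
              (max 0 ((∑ i ∈ I, ((i : ℕ) + 1 : ℝ) * a i) +
                (∑ i ∈ I', ((i : ℕ) + 1 : ℝ) * b i) +
                (∑ i ∈ I'', ((i : ℕ) + 1 : ℝ) * c i) - 1) + ε ^ 2)) := by
  set η : ℝ := ε / (12 * (d + 1)) with hη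
  have hη0 : 0 < η := by positivity
  have hη1 : η ≤ 1 := by
    rw [hη, div_le_one (by positivity)]
    linarith [(Nat.cast_nonneg d : (0 : ℝ) ≤ d)]
  have hηd : η * (d * 3 : ℕ) ≤ ε / 4 := by
    rw [hη, div_mul_eq_mul_div, div_le_div_iff₀ (by positivity) (by norm_num)]
    push_cast
    linarith
  obtain ⟨K, hK1, hK⟩ := exists_card_divisors_le_rpow hη0
  set D : ℝ := 2 ^ (∑ i : Fin d, ((i : ℕ) + 1)) with hD
  have hD1 : 1 ≤ D := one_le_pow₀ (by norm_num)
  refine ⟨(K * D) ^ (d * 3) * ((3 ^ d) ^ 3 * (2 * D ^ 3)), ?_, ?_⟩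
  · exact one_le_mul_of_one_le_of_one_le (one_le_pow₀ (one_le_mul_of_one_le_of_one_le hK1 hD1))
      (one_le_mul_of_one_le_of_one_le (one_le_pow₀ (one_le_pow₀ (by norm_num)))
        (one_le_mul_of_one_le_of_one_le (by norm_num) (one_le_pow₀ hD1)))
  intro X hX a b c ha hb hc hsa hsb hsc hsc' c₁ c₂ c₃ hc₃ I I' I''
  have hX0 : 0 < X := by linarith
  have hX1 : 1 ≤ X := by linarith
  set M : ℕ := ⌊(K * (D * X) ^ η) ^ d⌋₊
  have hone : ∀ {a : Fin d → ℝ}, (∀ i, 0 ≤ a i) → ∀ i, 1 ≤ X ^ a i :=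
    fun ha i => Real.one_le_rpow hX1 (ha i)
  have hfull : ∀ {a : Fin d → ℝ}, (∑ i : Fin d, ((i : ℕ) + 1 : ℝ) * a i ≤ 1) →
      ∏ i, (X ^ a i) ^ ((i : ℕ) + 1) ≤ X := fun {a} ha => by
    rw [prod_rpow_pow_eq_rpow_sum hX0]
    exact (Real.rpow_le_rpow_of_exponent_le hX1 ha).trans_eq (Real.rpow_one X)
  have hM : ∀ n : ℕ, n ≠ 0 → (n : ℝ) ≤ D * X → #n.divisors ^ d ≤ M := by
    intro n hn hnX
    refine Nat.le_floor ?_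
    push_cast
    have : (#n.divisors : ℝ) ≤ K * (D * X) ^ η := (hK n hn).trans (by gcongr)
    gcongr
  have hM3 : (M : ℝ) ^ 3 ≤ (K * D) ^ (d * 3) * X ^ (ε / 4) := by
    have h1 : (M : ℝ) ≤ (K * (D * X) ^ η) ^ d := Nat.floor_le (by positivity)
    have h2 : (D * X) ^ η ≤ D * X ^ η := by
      rw [Real.mul_rpow (by positivity) hX0.le]
      gcongr
      exact (Real.rpow_le_rpow_of_exponent_le hD1 hη1).trans_eq (Real.rpow_one D)
    calc (M : ℝ) ^ 3 ≤ ((K * (D * X ^ η)) ^ d) ^ 3 := by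
          gcongr
          exact h1.trans (by gcongr)
      _ = (K * D) ^ (d * 3) * X ^ (η * (d * 3 : ℕ)) := by
          rw [Real.rpow_mul hX0.le, Real.rpow_natCast, ← pow_mul, ← mul_assoc, mul_pow]
      _ ≤ _ := by gcongr
  have main := Bcount_le (c₁ := c₁) (c₂ := c₂) hc₃ (hone ha) (hone hb) (hone hc) (hfull hsa)
    (hfull hsb) (hfull hsc') hM I I' I''
  simp only [prod_rpow_eq_rpow_sum hX0, prod_rpow_pow_eq_rpow_sum hX0] at main
  rw [← hD] at main
  set σ : ℝ := (∑ i ∈ I, ((i : ℕ) + 1 : ℝ) * a i) + (∑ i ∈ I', ((i : ℕ) + 1 : ℝ) * b i) +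
    (∑ i ∈ I'', ((i : ℕ) + 1 : ℝ) * c i) - 1 with hσ
  have hR : D ^ 3 * (X ^ (∑ i ∈ I, ((i : ℕ) + 1 : ℝ) * a i) *
      X ^ (∑ i ∈ I', ((i : ℕ) + 1 : ℝ) * b i) /
      X ^ (∑ i ∈ I''ᶜ, ((i : ℕ) + 1 : ℝ) * c i)) + 1 ≤ 2 * D ^ 3 * X ^ (max 0 σ + ε ^ 2) := by
    rw [← Real.rpow_add hX0, ← Real.rpow_sub hX0]
    rw [← sum_add_sum_compl I'' fun i : Fin d => ((i : ℕ) + 1 : ℝ) * c i] at hsc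
    have h1 : 1 ≤ D ^ 3 * X ^ (max 0 σ + ε ^ 2) :=
      one_le_mul_of_one_le_of_one_le (one_le_pow₀ hD1) (Real.one_le_rpow hX1 (by positivity))
    have h2 : X ^ ((∑ i ∈ I, ((i : ℕ) + 1 : ℝ) * a i) + (∑ i ∈ I', ((i : ℕ) + 1 : ℝ) * b i) -
        ∑ i ∈ I''ᶜ, ((i : ℕ) + 1 : ℝ) * c i) ≤ X ^ (max 0 σ + ε ^ 2) :=
      Real.rpow_le_rpow_of_exponent_le hX1 (by linarith [le_max_right 0 σ])
    have h3 := mul_le_mul_of_nonneg_left h2 (by positivity : 0 ≤ D ^ 3)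
    linarith
  calc _ ≤ _ := main
    _ ≤ ((K * D) ^ (d * 3) * X ^ (ε / 4)) * (((3 ^ d * X ^ (∑ i ∈ Iᶜ, a i)) *
        ((3 ^ d * X ^ (∑ i ∈ I'ᶜ, b i)) * (3 ^ d * X ^ (∑ i ∈ I''ᶜ, c i)))) *
        (2 * D ^ 3 * X ^ (max 0 σ + ε ^ 2))) := by
      gcongr
    _ = _ := by
      rw [Real.rpow_add hX0 _ (max 0 σ + ε ^ 2), Real.rpow_add hX0 (ε / 4),
        Real.rpow_add hX0 _ (∑ i ∈ I''ᶜ, c i),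
        Real.rpow_add hX0 (∑ i ∈ Iᶜ, a i)]
      ring

/-- The sharpest form of the geometry bound; the stated inequalities are consequences. -/
theorem exists_nu_le (d : ℕ) {ε : ℝ} (hε : 0 < ε) (hε' : ε < 1 / 100) :
    ∃ X₀ : ℝ, ∀ X : ℝ, X₀ ≤ X → 2 ≤ X →
      ∀ a b c : Fin d → ℝ, (∀ i, 0 ≤ a i) → (∀ i, 0 ≤ b i) → (∀ i, 0 ≤ c i) →
        (∑ i : Fin d, ((i : ℕ) + 1 : ℝ) * a i ≤ 1) →
        (∑ i : Fin d, ((i : ℕ) + 1 : ℝ) * b i ≤ 1) →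
        (1 - ε ^ 2 ≤ ∑ i : Fin d, ((i : ℕ) + 1 : ℝ) * c i) →
        (∑ i : Fin d, ((i : ℕ) + 1 : ℝ) * c i ≤ 1) →
        ∀ c₁ c₂ c₃ : ℤ, c₃ ≠ 0 → ∀ I I' I'' : Finset (Fin d),
          nu d c₁ c₂ c₃ X a b c ε ≤
            3 * ε ^ 2 + ((∑ i ∈ Iᶜ, a i) + (∑ i ∈ I'ᶜ, b i) + (∑ i ∈ I''ᶜ, c i)) +
              max 0 ((∑ i ∈ I, ((i : ℕ) + 1 : ℝ) * a i) +
                (∑ i ∈ I', ((i : ℕ) + 1 : ℝ) * b i) +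
                (∑ i ∈ I'', ((i : ℕ) + 1 : ℝ) * c i) - 1) + ε / 2 := by
  obtain ⟨K, hK1, hK⟩ := exists_Bcount_le_rpow d hε hε'
  refine ⟨Real.exp (4 * Real.log K / ε), ?_⟩
  intro X hX₀ hX a b c ha hb hc hsa hsb hsc hsc' c₁ c₂ c₃ hc₃ I I' I''
  have hX0 : 0 < X := by linarith
  have hlogX : 0 < Real.log X := Real.log_pos (by linarith)
  have hKX : Real.log K ≤ ε / 4 * Real.log X := by
    have := (Real.le_log_iff_exp_le hX0).2 hX₀
    rw [div_le_iff₀ hε] at this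
    linarith
  have h := hK X hX a b c ha hb hc hsa hsb hsc hsc' c₁ c₂ c₃ hc₃ I I' I''
  have hA := sum_nonneg fun i (_ : i ∈ Iᶜ) => ha i
  have hB := sum_nonneg fun i (_ : i ∈ I'ᶜ) => hb i
  have hC := sum_nonneg fun i (_ : i ∈ I''ᶜ) => hc i
  set σ : ℝ := (∑ i ∈ I, ((i : ℕ) + 1 : ℝ) * a i) + (∑ i ∈ I', ((i : ℕ) + 1 : ℝ) * b i) +
    (∑ i ∈ I'', ((i : ℕ) + 1 : ℝ) * c i) - 1
  have hσ := le_max_left 0 σ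
  have hε2 := sq_nonneg ε
  unfold nu
  generalize Bcount d c₁ c₂ c₃ (fun i => X ^ a i) (fun i => X ^ b i) (fun i => X ^ c i) = B at *
  rcases Nat.eq_zero_or_pos B with rfl | hBpos
  · simp only [Nat.cast_zero, Real.log_zero, zero_div]
    linarith
  have hlog := Real.log_le_log (by exact_mod_cast hBpos) h
  rw [Real.log_mul (by linarith) (Real.rpow_pos_of_pos hX0 _).ne', Real.log_rpow hX0] at hlog
  have hdiv : Real.log B / Real.log X ≤ ε / 4 +
      (ε / 4 + ((∑ i ∈ Iᶜ, a i) + (∑ i ∈ I'ᶜ, b i) + (∑ i ∈ I''ᶜ, c i)) +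
        (max 0 σ + ε ^ 2)) := by
    rw [div_le_iff₀ hlogX]
    linarith
  linarith

theorem nu_geometry_bound (d : ℕ) (hd : 1 ≤ d) (ε δ : ℝ)
    (hε : 0 < ε) (hε' : ε < 1 / 100) (hδ : 0 < δ) (hδ' : δ < 1 / 10 ^ 100) :
    ∃ X₀ : ℝ, ∀ X : ℝ, X₀ ≤ X → 2 ≤ X →
      ∀ a b c : Fin d → ℝ,
        (∀ i, 0 ≤ a i) → (∀ i, 0 ≤ b i) → (∀ i, 0 ≤ c i) →
        (∑ i : Fin d, ((i : ℕ) + 1 : ℝ) * a i ≤ 1) →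
        (∑ i : Fin d, ((i : ℕ) + 1 : ℝ) * b i ≤ 1) →
        (1 - ε ^ 2 ≤ ∑ i : Fin d, ((i : ℕ) + 1 : ℝ) * c i) →
        (∑ i : Fin d, ((i : ℕ) + 1 : ℝ) * c i ≤ 1) →
        (∑ i, (a i + b i + c i) ≤ 1 + δ - ε) →
        ∀ c₁ c₂ c₃ : ℤ, c₁ ≠ 0 → c₂ ≠ 0 → c₃ ≠ 0 →
        (∀ I I' I'' : Finset (Fin d),
          nu d c₁ c₂ c₃ X a b c ε ≤
            δ + max 1 ((∑ i ∈ I, ((i : ℕ) + 1 : ℝ) * a i) +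
                (∑ i ∈ I', ((i : ℕ) + 1 : ℝ) * b i) + (∑ i ∈ I'', ((i : ℕ) + 1 : ℝ) * c i)) -
              (∑ i ∈ I, a i) - (∑ i ∈ I', b i) - (∑ i ∈ I'', c i) + ε) ∧
        (∀ I I' I'' : Finset (Fin d),
          nu d c₁ c₂ c₃ X a b c ε ≤
            4 * ε ^ 2 + (∑ i ∈ Iᶜ, a i) + (∑ i ∈ I'ᶜ, b i) + (∑ i ∈ I''ᶜ, c i) +
              max 0 ((∑ i ∈ I, ((i : ℕ) + 1 : ℝ) * a i) +
                (∑ i ∈ I', ((i : ℕ) + 1 : ℝ) * b i) +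
                (∑ i ∈ I'', ((i : ℕ) + 1 : ℝ) * c i) - 1) + ε) := by
  obtain ⟨X₀, h⟩ := exists_nu_le d hε hε'
  refine ⟨X₀, fun X hX₀ hX a b c ha hb hc hsa hsb hsc hsc' hsum c₁ c₂ c₃ _ _ hc₃ => ?_⟩
  have key := h X hX₀ hX a b c ha hb hc hsa hsb hsc hsc' c₁ c₂ c₃ hc₃
  have hε2 : ε ^ 2 < ε / 100 := by nlinarith
  refine ⟨fun I I' I'' => ?_, fun I I' I'' => ?_⟩
  · have k := key I I' I''
    rw [sum_add_distrib, sum_add_distrib, ← sum_add_sum_compl I a, ← sum_add_sum_compl I' b,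
      ← sum_add_sum_compl I'' c] at hsum
    set S := (∑ i ∈ I, ((i : ℕ) + 1 : ℝ) * a i) + (∑ i ∈ I', ((i : ℕ) + 1 : ℝ) * b i) +
      (∑ i ∈ I'', ((i : ℕ) + 1 : ℝ) * c i)
    have hmax : max 0 (S - 1) = max 1 S - 1 := by
      rw [← max_sub_sub_right, sub_self]
    rw [hmax] at k
    linarith
  · have k := key I I' I''
    have := sq_nonneg ε
    linarith
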